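/- Let R be a commutative noetherian ring, I an ideal of R, and π : mod(R/I) → mod R the restriction-of-scalars functor. Let X be a KE-closed subcategory of mod R, and let π^{-1}(X) be the subcategory of finitely generated R/I-modules M such that the underlying R-module of M lies in X. Then the natural injection f : Spec(R/I) → Spec R induces a bijection from Ass(π^{-1}(X)) onto Ass X ∩ V(I), where V(I) is the set of primes of R containing I. -/

import Mathlib

/-! Statement 16: Let `R` be a commutative noetherian ring, `I` an ideal,
`π : mod (R/I) → mod R` the restriction-of-scalars functor, and `X` a
KE-closed subcategory of `mod R`.  Then the natural injection
`Spec (R/I) → Spec R` (sending a prime to its preimage under the quotient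
map) induces a bijection from `Ass (π⁻¹ X)` onto `Ass X ∩ V(I)`. -/

open CategoryTheory

universe u

section Defs

variable (R : Type u) [CommRing R]

/-- `P` is a class of finitely generated `R`-modules (a subcategory of
`mod R`). -/
def IsSubcatOfFGMod (P : ModuleCat.{u} R → Prop) : Prop :=
  ∀ M : ModuleCat.{u} R, P M → Module.Finite R M

/-- `P` is an additive subcategory: it contains the zero modules and is
closed under isomorphisms and finite direct sums. -/
def MIsAdditive (P : ModuleCat.{u} R → Prop) : Prop :=
  (∀ M : ModuleCat.{u} R, Subsingleton M → P M) ∧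
  (∀ M N : ModuleCat.{u} R, (M ≃ₗ[R] N) → P M → P N) ∧
  (∀ M N : ModuleCat.{u} R, P M → P N → P (ModuleCat.of R (M × N)))

/-- `P` is closed under submodules. -/
def MClosedUnderSubmodules (P : ModuleCat.{u} R → Prop) : Prop :=
  ∀ (M : ModuleCat.{u} R) (N : Submodule R M), P M → P (ModuleCat.of R N)

/-- `P` is closed under kernels of `R`-linear maps between its members. -/
def MClosedUnderKernels (P : ModuleCat.{u} R → Prop) : Prop :=
  ∀ (M N : ModuleCat.{u} R) (f : M →ₗ[R] N), P M → P N →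
    P (ModuleCat.of R (LinearMap.ker f))

/-- `P` is closed under extensions: for every short exact sequence
`0 → N → M → M/N → 0`, if the two outer terms lie in `P` then so does `M`.
(Together with closure under isomorphisms this is equivalent to the usual
formulation with arbitrary short exact sequences.) -/
def MClosedUnderExtensions (P : ModuleCat.{u} R → Prop) : Prop :=
  ∀ (M : ModuleCat.{u} R) (N : Submodule R M),
    P (ModuleCat.of R N) → P (ModuleCat.of R (M ⧸ N)) → P M

/-- `P` is a torsion-free class of `mod R`: an additive subcategory of
finitely generated modules closed under submodules and extensions. -/
def MIsTorsionFreeClass (P : ModuleCat.{u} R → Prop) : Prop :=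
  IsSubcatOfFGMod R P ∧ MIsAdditive R P ∧ MClosedUnderSubmodules R P ∧
    MClosedUnderExtensions R P

/-- `P` is a KE-closed subcategory of `mod R`: an additive subcategory of
finitely generated modules closed under kernels and extensions. -/
def MIsKEClosed (P : ModuleCat.{u} R → Prop) : Prop :=
  IsSubcatOfFGMod R P ∧ MIsAdditive R P ∧ MClosedUnderKernels R P ∧
    MClosedUnderExtensions R P

/-- `Ass X`: the union of the associated primes of members of `X`. -/
def AssOf (P : ModuleCat.{u} R → Prop) : Set (Ideal R) :=
  {p | ∃ M : ModuleCat.{u} R, P M ∧ p ∈ associatedPrimes R M}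

/-- `mod^ass_Φ R`: the finitely generated modules all of whose associated
primes lie in `Φ`. -/
def modAss (Φ : Set (Ideal R)) : ModuleCat.{u} R → Prop :=
  fun M => Module.Finite R M ∧ associatedPrimes R M ⊆ Φ

end Defs

open Submodule in
/-- Along a surjective ring homomorphism, a prime is associated to a module exactly when its
preimage is associated to the restriction of scalars. -/
theorem mem_associatedPrimes_restrictScalars_iff {R S : Type u} [CommRing R] [CommRing S]
    {f : R →+* S} (hf : Function.Surjective f) (N : ModuleCat.{u} S) (q : Ideal S) :
    q.comap f ∈ associatedPrimes R ((ModuleCat.restrictScalars f).obj N) ↔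
      q ∈ associatedPrimes S N := by
  have radical_colon_eq (x : N) :
      (colon (⊥ : Submodule R ((ModuleCat.restrictScalars f).obj N))
        {(show (ModuleCat.restrictScalars f).obj N from x)}).radical =
        (colon (⊥ : Submodule S N) {x}).radical.comap f := by
    rw [Ideal.comap_radical]
    rfl
  constructor
  · rintro ⟨hq, x, hx⟩
    have heq : q = (colon (⊥ : Submodule S N) {(show N from x)}).radical :=
      Ideal.comap_injective_of_surjective f hf (hx.trans (radical_colon_eq x))
    refine ⟨?_, x, heq⟩
    rw [← Ideal.map_comap_of_surjective f hf q]
    exact Ideal.map_isPrime_of_surjective hf (Ideal.ker_le_comap f)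
  · rintro ⟨hq, x, rfl⟩
    exact ⟨Ideal.comap_isPrime f _, x, (radical_colon_eq x).symm⟩

/-- An associated prime containing `I` is associated to the `I`-torsion submodule. -/
theorem mem_associatedPrimes_torsionBySet {R M : Type*} [CommRing R] [IsNoetherianRing R]
    [AddCommGroup M] [Module R M] {I p : Ideal R} (hIp : I ≤ p)
    (hp : p ∈ associatedPrimes R M) :
    p ∈ associatedPrimes R (Submodule.torsionBySet R M (I : Set R)) := by
  obtain ⟨hprime, x, rfl⟩ := Submodule.isAssociatedPrime_iff.mp hp
  refine Submodule.isAssociatedPrime_iff.mpr ⟨hprime, ⟨x, ?_⟩, ?_⟩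
  · rw [Submodule.mem_torsionBySet_iff]
    rintro ⟨a, ha⟩
    simpa using hIp ha
  · ext r
    simp [Submodule.mem_colon_singleton, Subtype.ext_iff]

/-- An additive subcategory contains the finite powers of its members. -/
theorem MIsAdditive.pi_fin {R : Type u} [CommRing R] {P : ModuleCat.{u} R → Prop}
    (hP : MIsAdditive R P) {M : ModuleCat.{u} R} (hM : P M) (n : ℕ) :
    P (ModuleCat.of R (Fin n → M)) := by
  induction n with
  | zero => exact hP.1 _ (inferInstanceAs (Subsingleton (Fin 0 → M)))
  | succ n ih =>
    exact hP.2.1 _ _ (Fin.consLinearEquiv R fun _ : Fin (n + 1) => M)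
      (hP.2.2 _ _ hM ih)

/-- An additive subcategory closed under kernels contains the `I`-torsion submodules of its
members, for `I` finitely generated. -/
theorem MClosedUnderKernels.torsionBySet {R : Type u} [CommRing R] {P : ModuleCat.{u} R → Prop}
    (hker : MClosedUnderKernels R P) (hadd : MIsAdditive R P) {I : Ideal R} (hI : I.FG)
    {M : ModuleCat.{u} R} (hM : P M) :
    P (ModuleCat.of R (Submodule.torsionBySet R M (I : Set R))) := by
  obtain ⟨n, a, rfl⟩ := Submodule.fg_iff_exists_fin_generating_family.mp hI
  let f : M →ₗ[R] Fin n → M := LinearMap.pi fun i => LinearMap.lsmul R M (a i)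
  have hf : LinearMap.ker f =
      Submodule.torsionBySet R M (Submodule.span R (Set.range a) : Set R) := by
    ext x
    rw [← Ideal.span, ← Submodule.torsionBySet_eq_torsionBySet_span]
    simp only [f, LinearMap.mem_ker, funext_iff, LinearMap.pi_apply, LinearMap.lsmul_apply,
      Pi.zero_apply, Submodule.mem_torsionBySet_iff, Subtype.forall, Set.forall_mem_range]
  rw [← hf]
  exact hker M (ModuleCat.of R (Fin n → M)) f hM (hadd.pi_fin hM n)

theorem assOf_restrictScalars_bijOn (R : Type u) [CommRing R]
    [IsNoetherianRing R] (I : Ideal R)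
    (X : ModuleCat.{u} R → Prop) (hX : MIsKEClosed R X) :
    Set.BijOn (fun q : Ideal (R ⧸ I) => q.comap (Ideal.Quotient.mk I))
      (AssOf (R ⧸ I) (fun N : ModuleCat.{u} (R ⧸ I) =>
        X ((ModuleCat.restrictScalars (Ideal.Quotient.mk I)).obj N)))
      (AssOf R X ∩ {p : Ideal R | I ≤ p}) := by
  obtain ⟨-, hadd, hker, -⟩ := hX
  have hsurj := Ideal.Quotient.mk_surjective (I := I)
  refine ⟨?_, (Ideal.comap_injective_of_surjective _ hsurj).injOn, ?_⟩
  · rintro q ⟨N, hN, hq⟩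
    refine ⟨⟨_, hN, (mem_associatedPrimes_restrictScalars_iff hsurj N q).mpr hq⟩, ?_⟩
    exact I.mk_ker.symm.le.trans (Ideal.ker_le_comap _)
  · rintro p ⟨⟨M, hM, hp⟩, hIp⟩
    let T := Submodule.torsionBySet R M (I : Set R)
    let N := ModuleCat.of (R ⧸ I) T
    let e : T ≃ₗ[R] (ModuleCat.restrictScalars (Ideal.Quotient.mk I)).obj N :=
      { AddEquiv.refl T with map_smul' := fun _ _ => rfl }
    have hcomap : (p.map (Ideal.Quotient.mk I)).comap (Ideal.Quotient.mk I) = p :=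
      Ideal.comap_map_mk hIp
    refine ⟨p.map (Ideal.Quotient.mk I), ⟨N, ?_, ?_⟩, hcomap⟩
    · exact hadd.2.1 (ModuleCat.of R T) _ e
        (hker.torsionBySet hadd (IsNoetherian.noetherian I) hM)
    · rw [← mem_associatedPrimes_restrictScalars_iff hsurj, hcomap,
        ← LinearEquiv.AssociatedPrimes.eq e]
      exact mem_associatedPrimes_torsionBySet hIp hp
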